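/- Let G be a claw-o-heavy graph of order n, and let u, v be two vertices of G such that no maximal clique of the closure cl(G) contains both u and v (u and v are dissociated). Then d_G(u) + d_G(v) < n and d_{cl(G)}(u) + d_{cl(G)}(v) < n. -/

import Mathlib

/-- The degree of a vertex, as the cardinality of its neighbor set. -/
noncomputable def deg {V : Type*} (G : SimpleGraph V) (v : V) : ℕ :=
  (G.neighborSet v).ncard

/-- A pair of vertices of a graph `G` of order `n` is heavy if its degree sum is
at least `n`. -/
def HeavyPair {V : Type*} [Fintype V] (G : SimpleGraph V) (u v : V) : Prop :=
  Fintype.card V ≤ deg G u + deg G v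

/-- A graph `G` of order `n` is claw-o-heavy if every induced copy of the claw `K_{1,3}`
(with center `a` and leaves `b₁, b₂, b₃`) contains two nonadjacent vertices whose
degree sum in `G` is at least `n`. -/
def ClawOHeavy {V : Type*} [Fintype V] (G : SimpleGraph V) : Prop :=
  ∀ a b₁ b₂ b₃ : V, b₁ ≠ b₂ → b₁ ≠ b₃ → b₂ ≠ b₃ →
    G.Adj a b₁ → G.Adj a b₂ → G.Adj a b₃ →
    ¬ G.Adj b₁ b₂ → ¬ G.Adj b₁ b₃ → ¬ G.Adj b₂ b₃ →
    ∃ u v : V, u ∈ ({a, b₁, b₂, b₃} : Set V) ∧ v ∈ ({a, b₁, b₂, b₃} : Set V) ∧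
      u ≠ v ∧ ¬ G.Adj u v ∧ HeavyPair G u v

/-- The local completion of `G` at `x`: add all missing edges between neighbors
of `x`. -/
def LocalCompletion {V : Type*} (G : SimpleGraph V) (x : V) : SimpleGraph V :=
  G ⊔ SimpleGraph.fromRel (fun u v => G.Adj x u ∧ G.Adj x v)

/-- The graph `G^o_x`: add to `G` all edges `uv` with `u, v ∈ N(x)` and `{u, v}` a
heavy pair of `G`. -/
def Gox {V : Type*} [Fintype V] (G : SimpleGraph V) (x : V) : SimpleGraph V :=
  G ⊔ SimpleGraph.fromRel (fun u v => G.Adj x u ∧ G.Adj x v ∧ HeavyPair G u v)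

/-- A vertex `x` is o-eligible in `G` if `N(x)` is not a clique and either
`G^o_x[N(x)]` is connected, or `G^o_x[N(x)]` consists of two disjoint cliques
`C₁, C₂` and there is a join vertex of `x`: a vertex `z ∉ {x} ∪ N(x)` with `{x, z}`
a heavy pair of `G` that is adjacent in `G` to some vertex of `C₁` and to some
vertex of `C₂`. -/
def IsOEligible {V : Type*} [Fintype V] (G : SimpleGraph V) (x : V) : Prop :=
  ¬ G.IsClique (G.neighborSet x) ∧
  ( ((Gox G x).induce (G.neighborSet x)).Connected ∨
    ∃ C₁ C₂ : Set V, C₁.Nonempty ∧ C₂.Nonempty ∧ Disjoint C₁ C₂ ∧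
      C₁ ∪ C₂ = G.neighborSet x ∧
      (Gox G x).IsClique C₁ ∧ (Gox G x).IsClique C₂ ∧
      (∀ u ∈ C₁, ∀ v ∈ C₂, ¬ (Gox G x).Adj u v) ∧
      ∃ z : V, z ≠ x ∧ z ∉ G.neighborSet x ∧ HeavyPair G x z ∧
        ∃ y₁ ∈ C₁, ∃ y₂ ∈ C₂, G.Adj z y₁ ∧ G.Adj z y₂ )

/-- `H` is the closure `cl(G)` of `G`: it is obtained from `G` by iteratively
performing local completions at o-eligible vertices until no o-eligible vertex
remains. -/
def IsClosure {V : Type*} [Fintype V] (G H : SimpleGraph V) : Prop :=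
  ∃ (t : ℕ) (Gs : ℕ → SimpleGraph V) (xs : ℕ → V),
    Gs 0 = G ∧ Gs t = H ∧
    (∀ i < t, IsOEligible (Gs i) (xs i) ∧ Gs (i + 1) = LocalCompletion (Gs i) (xs i)) ∧
    (∀ y : V, ¬ IsOEligible H y)

/-- `s` is a maximal clique of `H`. -/
def IsMaxClique {V : Type*} (H : SimpleGraph V) (s : Set V) : Prop :=
  H.IsClique s ∧ ∀ t : Set V, H.IsClique t → s ⊆ t → s = t

theorem deg_mono {V : Type*} [Finite V] {G H : SimpleGraph V} (h : G ≤ H) (v : V) :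
    deg G v ≤ deg H v :=
  Set.ncard_le_ncard (fun _ hw => h hw) (Set.toFinite _)

theorem HeavyPair.mono {V : Type*} [Fintype V] {G H : SimpleGraph V} (h : G ≤ H) {u v : V}
    (huv : HeavyPair G u v) : HeavyPair H u v :=
  huv.trans (Nat.add_le_add (deg_mono h u) (deg_mono h v))

theorem HeavyPair.symm {V : Type*} [Fintype V] {G : SimpleGraph V} {u v : V}
    (huv : HeavyPair G u v) : HeavyPair G v u := by
  unfold HeavyPair at *
  omega

/-- In a claw-o-heavy graph, two leaves of every induced claw form a heavy pair. -/
theorem ClawOHeavy.heavyPair {V : Type*} [Fintype V] {G : SimpleGraph V} (hG : ClawOHeavy G)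
    {a b₁ b₂ b₃ : V} (h12 : b₁ ≠ b₂) (h13 : b₁ ≠ b₃) (h23 : b₂ ≠ b₃)
    (h1 : G.Adj a b₁) (h2 : G.Adj a b₂) (h3 : G.Adj a b₃)
    (n12 : ¬ G.Adj b₁ b₂) (n13 : ¬ G.Adj b₁ b₃) (n23 : ¬ G.Adj b₂ b₃) :
    HeavyPair G b₁ b₂ ∨ HeavyPair G b₁ b₃ ∨ HeavyPair G b₂ b₃ := by
  obtain ⟨u, v, hu, hv, hne, hn, hh⟩ := hG a b₁ b₂ b₃ h12 h13 h23 h1 h2 h3 n12 n13 n23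
  have hh' := hh.symm
  simp only [Set.mem_insert_iff, Set.mem_singleton_iff] at hu hv
  rcases hu with rfl | rfl | rfl | rfl <;> rcases hv with rfl | rfl | rfl | rfl <;>
    first
    | exact absurd rfl hne
    | exact absurd ‹_› hn
    | exact absurd (SimpleGraph.Adj.symm ‹_›) hn
    | simp only [*, true_or, or_true]

theorem localCompletion_adj {V : Type*} {G : SimpleGraph V} {x u v : V} :
    (LocalCompletion G x).Adj u v ↔ G.Adj u v ∨ u ≠ v ∧ G.Adj x u ∧ G.Adj x v := by
  simp only [LocalCompletion, SimpleGraph.sup_adj, SimpleGraph.fromRel_adj]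
  tauto

theorem gox_adj {V : Type*} [Fintype V] {G : SimpleGraph V} {x u v : V} :
    (Gox G x).Adj u v ↔
      G.Adj u v ∨ u ≠ v ∧ G.Adj x u ∧ G.Adj x v ∧ HeavyPair G u v := by
  have := @HeavyPair.symm V _ G u v
  have := @HeavyPair.symm V _ G v u
  simp only [Gox, SimpleGraph.sup_adj, SimpleGraph.fromRel_adj]
  tauto

theorem deg_le_deg_localCompletion {V : Type*} [Finite V] {G : SimpleGraph V} {x b : V}
    (h : G.Adj x b) : deg G x ≤ deg (LocalCompletion G x) b := by
  have hx : x ∉ G.neighborSet x := by simp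
  rw [deg, ← Set.ncard_exchange hx (show b ∈ G.neighborSet x from h)]
  refine Set.ncard_le_ncard ?_ (Set.toFinite _)
  rintro c (rfl | ⟨hc, hcb⟩)
  · exact localCompletion_adj.2 (Or.inl h.symm)
  · exact localCompletion_adj.2 (Or.inr ⟨fun e => hcb e.symm, h, hc⟩)

/-- A claw of a local completion that uses a new edge at a leaf `b₁` has a heavy pair of leaves. -/
theorem ClawOHeavy.heavyPair_localCompletion {V : Type*} [Fintype V] {G : SimpleGraph V}
    (hG : ClawOHeavy G) {x a b₁ b₂ b₃ : V} (h12 : b₁ ≠ b₂) (h13 : b₁ ≠ b₃) (h23 : b₂ ≠ b₃)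
    (hxa : G.Adj x a) (hxb : G.Adj x b₁)
    (h2 : (LocalCompletion G x).Adj a b₂) (h3 : (LocalCompletion G x).Adj a b₃)
    (n12 : ¬ (LocalCompletion G x).Adj b₁ b₂) (n13 : ¬ (LocalCompletion G x).Adj b₁ b₃)
    (n23 : ¬ (LocalCompletion G x).Adj b₂ b₃) :
    HeavyPair (LocalCompletion G x) b₁ b₂ ∨ HeavyPair (LocalCompletion G x) b₁ b₃ ∨
      HeavyPair (LocalCompletion G x) b₂ b₃ := by
  have hle : G ≤ LocalCompletion G x := fun _ _ h => localCompletion_adj.2 (Or.inl h)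
  have key : ∀ c, HeavyPair G x c → HeavyPair (LocalCompletion G x) b₁ c := fun c hc =>
    hc.trans (Nat.add_le_add (deg_le_deg_localCompletion hxb) (deg_mono hle c))
  simp only [localCompletion_adj] at h2 h3 n12 n13 n23
  have hx2 : x ≠ b₂ := by rintro rfl; exact n12 (Or.inl hxb.symm)
  have hx3 : x ≠ b₃ := by rintro rfl; exact n13 (Or.inl hxb.symm)
  rcases hG.heavyPair (a := a) hx2 hx3 h23 hxa.symm (by tauto) (by tauto) (by tauto) (by tauto)
    (by tauto) with h | h | h
  · exact Or.inl (key _ h)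
  · exact Or.inr (Or.inl (key _ h))
  · exact Or.inr (Or.inr (h.mono hle))

theorem ClawOHeavy.localCompletion {V : Type*} [Fintype V] {G : SimpleGraph V}
    (hG : ClawOHeavy G) (x : V) : ClawOHeavy (LocalCompletion G x) := by
  intro a b₁ b₂ b₃ h12 h13 h23 h1 h2 h3 n12 n13 n23
  have hle : G ≤ LocalCompletion G x := fun _ _ h => localCompletion_adj.2 (Or.inl h)
  have main : HeavyPair (LocalCompletion G x) b₁ b₂ ∨ HeavyPair (LocalCompletion G x) b₁ b₃ ∨
      HeavyPair (LocalCompletion G x) b₂ b₃ := by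
    rcases localCompletion_adj.1 h1 with o1 | ⟨-, hxa, hxb⟩
    · rcases localCompletion_adj.1 h2 with o2 | ⟨-, hxa, hxb⟩
      · rcases localCompletion_adj.1 h3 with o3 | ⟨-, hxa, hxb⟩
        · exact (hG.heavyPair h12 h13 h23 o1 o2 o3 (fun h => n12 (hle h)) (fun h => n13 (hle h))
            (fun h => n23 (hle h))).imp (·.mono hle) (Or.imp (·.mono hle) (·.mono hle))
        · rcases hG.heavyPair_localCompletion h13.symm h23.symm h12 hxa hxb h1 h2
            (fun h => n13 h.symm) (fun h => n23 h.symm) n12 with h | h | h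
          · exact Or.inr (Or.inl h.symm)
          · exact Or.inr (Or.inr h.symm)
          · exact Or.inl h
      · rcases hG.heavyPair_localCompletion h12.symm h23 h13 hxa hxb h1 h3
          (fun h => n12 h.symm) n23 n13 with h | h | h
        · exact Or.inl h.symm
        · exact Or.inr (Or.inr h)
        · exact Or.inr (Or.inl h)
    · exact hG.heavyPair_localCompletion h12 h13 h23 hxa hxb h2 h3 n12 n13 n23
  rcases main with h | h | h
  · exact ⟨b₁, b₂, by simp, by simp, h12, n12, h⟩
  · exact ⟨b₁, b₃, by simp, by simp, h13, n13, h⟩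
  · exact ⟨b₂, b₃, by simp, by simp, h23, n23, h⟩

theorem IsClosure.le_and_clawOHeavy {V : Type*} [Fintype V] {G H : SimpleGraph V}
    (hH : IsClosure G H) (hG : ClawOHeavy G) : G ≤ H ∧ ClawOHeavy H := by
  obtain ⟨t, Gs, xs, h0, ht, hstep, -⟩ := hH
  have : ∀ i ≤ t, G ≤ Gs i ∧ ClawOHeavy (Gs i) := by
    intro i
    induction i with
    | zero => exact fun _ => ⟨h0.ge, by rwa [h0]⟩
    | succ i ih =>
      intro hi
      obtain ⟨hle, hc⟩ := ih (by omega)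
      rw [(hstep i hi).2]
      exact ⟨hle.trans fun _ _ h => localCompletion_adj.2 (Or.inl h), hc.localCompletion _⟩
  exact ht ▸ this t le_rfl

/-- The neighborhood of a vertex that is not o-eligible is a clique, or it splits into two cliques
of `G^o_x` without a join vertex. The first part may be chosen to contain a given neighbor. -/
theorem ClawOHeavy.exists_partition {V : Type*} [Fintype V] {G : SimpleGraph V}
    (hG : ClawOHeavy G) {x a : V} (hx : ¬ IsOEligible G x)
    (hcl : ¬ G.IsClique (G.neighborSet x)) (ha : G.Adj x a) :
    ∃ C₁ C₂ : Set V, a ∈ C₁ ∧ C₂.Nonempty ∧ C₁ ∪ C₂ = G.neighborSet x ∧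
      (Gox G x).IsClique C₁ ∧ (Gox G x).IsClique C₂ ∧
      (∀ u ∈ C₁, ∀ v ∈ C₂, u ≠ v ∧ ¬ (Gox G x).Adj u v) ∧
      ∀ z, z ≠ x → ¬ G.Adj x z → HeavyPair G x z →
        ∀ y₁ ∈ C₁, ∀ y₂ ∈ C₂, G.Adj z y₁ → ¬ G.Adj z y₂ := by
  let K := (Gox G x).induce (G.neighborSet x)
  have hK : ¬ K.Connected := fun h => hx ⟨hcl, Or.inl h⟩
  have hclaw : ∀ c₁ c₂ c₃ : G.neighborSet x, c₁ ≠ c₂ → c₁ ≠ c₃ → c₂ ≠ c₃ →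
      ¬ K.Adj c₁ c₃ → ¬ K.Adj c₂ c₃ → K.Adj c₁ c₂ := by
    rintro ⟨c₁, h1⟩ ⟨c₂, h2⟩ ⟨c₃, h3⟩ h12 h13 h23 n13 n23
    by_contra n12
    simp only [K, SimpleGraph.comap_adj, Function.Embedding.subtype_apply, gox_adj, ne_eq,
      Subtype.mk.injEq] at *
    have := hG.heavyPair h12 h13 h23 h1 h2 h3
    tauto
  let a' : G.neighborSet x := ⟨a, ha⟩
  obtain ⟨b, hb⟩ : ∃ b, ¬ K.Reachable a' b := by
    by_contra! h
    have : Nonempty (G.neighborSet x) := ⟨a'⟩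
    exact hK ⟨fun c d => (h c).symm.trans (h d)⟩
  have hsep : ∀ c d, K.Reachable a' c → ¬ K.Reachable a' d → c ≠ d ∧ ¬ K.Adj c d :=
    fun c d hc hd => ⟨fun e => hd (e ▸ hc), fun h => hd (hc.trans h.reachable)⟩
  let C₁ : Set V := Subtype.val '' {c | K.Reachable a' c}
  let C₂ : Set V := Subtype.val '' {c | ¬ K.Reachable a' c}
  have hcross : ∀ u ∈ C₁, ∀ v ∈ C₂, u ≠ v ∧ ¬ (Gox G x).Adj u v := by
    rintro _ ⟨c, hc, rfl⟩ _ ⟨d, hd, rfl⟩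
    exact ⟨fun e => (hsep c d hc hd).1 (Subtype.ext e), (hsep c d hc hd).2⟩
  have hunion : C₁ ∪ C₂ = G.neighborSet x := by
    rw [← Set.image_union]
    ext y
    simp only [Set.mem_image, Set.mem_union, Set.mem_ofPred_eq, em, true_and]
    simp
  have hcl1 : (Gox G x).IsClique C₁ := by
    rintro _ ⟨c, hc, rfl⟩ _ ⟨d, hd, rfl⟩ hne
    exact hclaw c d b (fun e => hne (e ▸ rfl)) (hsep c b hc hb).1 (hsep d b hd hb).1
      (hsep c b hc hb).2 (hsep d b hd hb).2
  have hcl2 : (Gox G x).IsClique C₂ := by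
    rintro _ ⟨c, hc, rfl⟩ _ ⟨d, hd, rfl⟩ hne
    have h1 := hsep a' c .rfl hc
    have h2 := hsep a' d .rfl hd
    exact hclaw c d a' (fun e => hne (e ▸ rfl)) h1.1.symm h2.1.symm
      (fun h => h1.2 h.symm) (fun h => h2.2 h.symm)
  have ha1 : a ∈ C₁ := ⟨a', .rfl, rfl⟩
  have hb2 : C₂.Nonempty := ⟨b, b, hb, rfl⟩
  refine ⟨C₁, C₂, ha1, hb2, hunion, hcl1, hcl2, hcross, ?_⟩
  intro z hzx hz hh y₁ hy₁ y₂ hy₂ hzy₁ hzy₂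
  exact hx ⟨hcl, Or.inr ⟨C₁, C₂, ⟨a, ha1⟩, hb2,
    Set.disjoint_left.2 fun c h1 h2 => (hcross c h1 c h2).1 rfl, hunion, hcl1, hcl2,
    fun u hu v hv => (hcross u hu v hv).2, z, hzx, hz, hh, y₁, hy₁, y₂, hy₂, hzy₁, hzy₂⟩⟩

/-- In a graph without o-eligible vertices, two common neighbors of a nonadjacent heavy pair are
adjacent or form a heavy pair. -/
theorem ClawOHeavy.adj_or_heavyPair_of_common_neighbors {V : Type*} [Fintype V]
    {H : SimpleGraph V} (hH : ClawOHeavy H) (hcl : ∀ x, ¬ IsOEligible H x) {u v w w' : V}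
    (huv : u ≠ v) (hn : ¬ H.Adj u v) (hh : HeavyPair H u v) (hw : H.Adj u w) (hvw : H.Adj v w)
    (hw' : H.Adj u w') (hvw' : H.Adj v w') (hne : w ≠ w') :
    H.Adj w w' ∨ HeavyPair H w w' := by
  by_cases hc : H.IsClique (H.neighborSet u)
  · exact Or.inl (hc hw hw' hne)
  obtain ⟨C₁, C₂, h1, -, hU, k1, -, -, hz⟩ := hH.exists_partition (hcl u) hc hw
  have hmem : w' ∈ C₁ ∪ C₂ := hU ▸ hw'
  rcases hmem with h | h
  · exact (gox_adj.1 (k1 h1 h hne)).imp id fun h => h.2.2.2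
  · exact absurd hvw' (hz v huv.symm hn hh w h1 w' h hvw)

/-- In a graph without o-eligible vertices, every common neighbor `w` of a nonadjacent heavy pair
`u, v` has a private neighbor outside the closed neighborhoods of `u` and `v`. -/
theorem ClawOHeavy.exists_private_neighbor {V : Type*} [Fintype V]
    {H : SimpleGraph V} (hH : ClawOHeavy H) (hcl : ∀ x, ¬ IsOEligible H x) {u v w : V}
    (huv : u ≠ v) (hn : ¬ H.Adj u v) (hh : HeavyPair H u v) (hw : H.Adj u w)
    (hvw : H.Adj v w) :
    ∃ y, H.Adj w y ∧ y ≠ u ∧ y ≠ v ∧ ¬ H.Adj u y ∧ ¬ H.Adj v y ∧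
      ∀ w', H.Adj u w' → H.Adj v w' → w ≠ w' → ¬ H.Adj w' y := by
  have hc : ¬ H.IsClique (H.neighborSet w) := fun h => hn (h hw.symm hvw.symm huv)
  obtain ⟨C₁, C₂, hu1, ⟨y, hy⟩, hU, -, -, hX, hz⟩ := hH.exists_partition (hcl w) hc hw.symm
  have hmem : ∀ c, H.Adj w c → (Gox H w).Adj u c → c ∈ C₁ := by
    intro c hc huc
    have : c ∈ C₁ ∪ C₂ := hU ▸ hc
    exact this.resolve_right fun h => (hX u hu1 c h).2 huc
  have hv1 : v ∈ C₁ :=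
    hmem v hvw.symm (gox_adj.2 (Or.inr ⟨huv, hw.symm, hvw.symm, hh⟩))
  have hwy : H.Adj w y := by
    have : y ∈ H.neighborSet w := hU ▸ Or.inr hy
    exact this
  have hno : ∀ c ∈ C₁, ¬ H.Adj c y := fun c hc h => (hX c hc y hy).2 (gox_adj.2 (Or.inl h))
  refine ⟨y, hwy, (hX u hu1 y hy).1.symm, (hX v hv1 y hy).1.symm, hno u hu1, hno v hv1, ?_⟩
  intro w' hw' hvw' hne hadj
  by_cases hww : H.Adj w w'
  · exact hno w' (hmem w' hww (gox_adj.2 (Or.inl hw'))) hadj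
  · have hheavy := (hH.adj_or_heavyPair_of_common_neighbors hcl huv hn hh hw hvw hw' hvw'
      hne).resolve_left hww
    exact hz w' hne.symm hww hheavy u hu1 y hy hw'.symm hadj

theorem ClawOHeavy.deg_add_deg_lt {V : Type*} [Fintype V]
    {H : SimpleGraph V} (hH : ClawOHeavy H) (hcl : ∀ x, ¬ IsOEligible H x) {u v : V}
    (huv : u ≠ v) (hn : ¬ H.Adj u v) : deg H u + deg H v < Fintype.card V := by
  by_contra! hh
  choose! f hf using fun w (hw : H.Adj u w ∧ H.Adj v w) =>
    hH.exists_private_neighbor hcl huv hn hh hw.1 hw.2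
  let U : Set V := H.neighborSet u ∪ H.neighborSet v
  have h1 : (H.neighborSet u ∩ H.neighborSet v).ncard ≤ (U ∪ {u, v})ᶜ.ncard := by
    refine Set.ncard_le_ncard_of_injOn f (fun w hw => ?_) ?_ (Set.toFinite _)
    · obtain ⟨-, hu, hv, nu, nv, -⟩ := hf w hw
      simp [U, hu, hv, nu, nv]
    · intro w hw w' hw' e
      by_contra hne
      exact (hf w hw).2.2.2.2.2 w' hw'.1 hw'.2 hne (e ▸ (hf w' hw').1)
  have h2 : (U ∪ {u, v}).ncard = U.ncard + 2 := by
    rw [Set.ncard_union_eq _ (Set.toFinite _) (Set.toFinite _), Set.ncard_pair huv]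
    have hn' : ¬ H.Adj v u := fun h => hn h.symm
    simp [U, hn, hn']
  have h3 := Set.ncard_add_ncard_compl (U ∪ {u, v})
  have h4 : U.ncard + (H.neighborSet u ∩ H.neighborSet v).ncard = deg H u + deg H v :=
    Set.ncard_union_add_ncard_inter _ _
  rw [Nat.card_eq_fintype_card] at h3
  omega

theorem exists_isMaxClique_superset {V : Type*} [Finite V] {H : SimpleGraph V} {s : Set V}
    (hs : H.IsClique s) : ∃ t, IsMaxClique H t ∧ s ⊆ t := by
  obtain ⟨t, hst, ht⟩ := (Set.toFinite {t : Set V | H.IsClique t}).exists_le_maximal hs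
  exact ⟨t, ⟨ht.prop, fun r hr htr => ht.eq_of_subset hr htr⟩, hst⟩


/-- If `G` is a claw-o-heavy graph of order `n` and `u, v` are dissociated vertices
(no maximal clique of the closure `cl(G)` contains both), then
`d_G(u) + d_G(v) < n` and `d_{cl(G)}(u) + d_{cl(G)}(v) < n`. -/
theorem stmt_15 {V : Type*} [Fintype V] (G : SimpleGraph V) (hclaw : ClawOHeavy G)
    (H : SimpleGraph V) (hH : IsClosure G H) (u v : V)
    (hdis : ¬ ∃ s : Set V, IsMaxClique H s ∧ u ∈ s ∧ v ∈ s) :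
    deg G u + deg G v < Fintype.card V ∧ deg H u + deg H v < Fintype.card V := by
  obtain ⟨hle, hc⟩ := hH.le_and_clawOHeavy hclaw
  obtain ⟨_, _, _, _, _, _, hcl⟩ := hH
  have hpair : ¬ H.IsClique {u, v} := fun h => by
    obtain ⟨t, ht, hsub⟩ := exists_isMaxClique_superset h
    exact hdis ⟨t, ht, hsub (by simp), hsub (by simp)⟩
  rw [SimpleGraph.isClique_pair] at hpair
  push Not at hpair
  have hlt := hc.deg_add_deg_lt hcl hpair.1 hpair.2
  exact ⟨(Nat.add_le_add (deg_mono hle u) (deg_mono hle v)).trans_lt hlt, hlt⟩
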